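/- arXiv:1806.10379 — 3 statements merged into one kernel-verified Lean document; each statement's English description precedes it below -/
import Mathlib

section
/- Let n ≥ 3, let σ = ±1, and let q_1,…,q_n be a solution of the curved n-body system on M_σ² of the centered circular type (with q_n fixed at the pole (0,0,1)), in which the masses of the n−1 bodies on the circle are all equal, m_1 = … = m_{n−1} = m > 0, and the mass m_n > 0 is arbitrary. Assume either σ = −1, or σ = 1 and r(t) < √10/5 for all t. If the minimal angular gap function μ₂ has a local minimum at some time t₀, then the n−1 bodies on the circle form a polygonal rotopulsator with regular polygon configuration: there exists a twice continuously differentiable function φ : ℝ → ℝ such that θ_i(t) = φ(t) + 2π(i−1)/(n−1) for all i ∈ {1,…,n−1} and all t. -/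
open Real

/-- The bilinear form `x ⊙ y = x₁y₁ + x₂y₂ + σx₃y₃` on `ℝ³ = ℝ × ℝ × ℝ`. -/
def odot (σ : ℝ) (x y : ℝ × ℝ × ℝ) : ℝ :=
  x.1 * y.1 + x.2.1 * y.2.1 + σ * x.2.2 * y.2.2

/-- The tangential force exerted by a unit mass at angular distance `d` on a circle of squared
radius `A`. -/
noncomputable def tangentialForce (σ A d : ℝ) : ℝ :=
  (A * (1 - cos d) * (2 - σ * (A * (1 - cos d)))) ^ (-(3 / 2 : ℝ)) * sin d

/-- The derivative of `tangentialForce σ A` with respect to the angular distance. -/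
noncomputable def tangentialForceDeriv (σ A d : ℝ) : ℝ :=
  (A * (1 - cos d) * (2 - σ * (A * (1 - cos d)))) ^ (-(5 / 2 : ℝ)) *
    (A * (1 - cos d) * (σ * (A * (1 - cos d)) * (3 + 2 * cos d) - (3 + cos d)))

/-- The squared radii for which the tangential force decreases with the angular distance. -/
def AdmissibleRadiusSq (σ A : ℝ) : Prop := 0 < A ∧ (σ = -1 ∨ σ = 1 ∧ A < 2 / 5)

theorem cos_lt_one_of_mem_Ioo {d : ℝ} (hd : d ∈ Set.Ioo 0 (2 * π)) : cos d < 1 := by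
  refine lt_of_le_of_ne (cos_le_one d) fun h => ?_
  rw [cos_eq_one_iff_of_lt_of_lt (by linarith [hd.1, pi_pos]) hd.2] at h
  exact hd.1.ne' h

theorem AdmissibleRadiusSq.base_pos {σ A d : ℝ} (h : AdmissibleRadiusSq σ A)
    (hd : d ∈ Set.Ioo 0 (2 * π)) :
    0 < A * (1 - cos d) * (2 - σ * (A * (1 - cos d))) := by
  obtain ⟨hA, h⟩ := h
  have hc := cos_lt_one_of_mem_Ioo hd
  have hc' := neg_one_le_cos d
  have hp : 0 < A * (1 - cos d) := mul_pos hA (by linarith)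
  refine mul_pos hp ?_
  rcases h with rfl | ⟨rfl, hA'⟩
  · linarith
  · nlinarith

theorem AdmissibleRadiusSq.hasDerivAt_tangentialForce {σ A d : ℝ} (h : AdmissibleRadiusSq σ A)
    (hd : d ∈ Set.Ioo 0 (2 * π)) :
    HasDerivAt (tangentialForce σ A) (tangentialForceDeriv σ A d) d := by
  have hb := h.base_pos hd
  have h1 : HasDerivAt (fun d => A * (1 - cos d)) (A * sin d) d := by
    simpa using ((hasDerivAt_cos d).const_sub 1).const_mul A
  have h2 := h1.mul ((h1.const_mul σ).const_sub 2)
  have h3 := (h2.rpow_const (p := -(3 / 2 : ℝ)) (Or.inl hb.ne')).mul (hasDerivAt_sin d)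
  refine h3.congr_deriv ?_
  simp only [Pi.mul_apply, tangentialForceDeriv]
  have e : -(3 / 2 : ℝ) - 1 = -(5 / 2) := by norm_num
  have e' : (A * (1 - cos d) * (2 - σ * (A * (1 - cos d)))) ^ (-(3 / 2 : ℝ)) =
      (A * (1 - cos d) * (2 - σ * (A * (1 - cos d)))) ^ (-(5 / 2 : ℝ)) *
      (A * (1 - cos d) * (2 - σ * (A * (1 - cos d)))) := by
    rw [← rpow_add_one hb.ne']; norm_num
  rw [e, e']
  have hs := sin_sq_add_cos_sq d
  have hs' : sin d ^ 2 = 1 - cos d ^ 2 := by linarith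
  generalize (A * (1 - cos d) * (2 - σ * (A * (1 - cos d)))) ^ (-(5 / 2 : ℝ)) = X
  linear_combination (X * (-3 / 2) * (A * (2 - σ * (A * (1 - cos d))) - A * (1 - cos d) * (σ * A))) * hs'

theorem AdmissibleRadiusSq.tangentialForceDeriv_neg {σ A d : ℝ} (h : AdmissibleRadiusSq σ A)
    (hd : d ∈ Set.Ioo 0 (2 * π)) : tangentialForceDeriv σ A d < 0 := by
  have hb := h.base_pos hd
  obtain ⟨hA, h⟩ := h
  have hc := cos_lt_one_of_mem_Ioo hd
  have hc' := neg_one_le_cos d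
  have hp : 0 < A * (1 - cos d) := mul_pos hA (by linarith)
  refine mul_neg_of_pos_of_neg (rpow_pos_of_pos hb _) (mul_neg_of_pos_of_neg hp ?_)
  rcases h with rfl | ⟨rfl, hA'⟩
  · nlinarith
  · have : A * (1 - cos d) * (3 + 2 * cos d) < 2 / 5 * (1 - cos d) * (3 + 2 * cos d) := by
      gcongr
      linarith
    nlinarith

theorem AdmissibleRadiusSq.strictAntiOn_tangentialForce {σ A : ℝ} (h : AdmissibleRadiusSq σ A) :
    StrictAntiOn (tangentialForce σ A) (Set.Ioo 0 (2 * π)) := by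
  refine strictAntiOn_of_deriv_neg (convex_Ioo _ _)
    (fun d hd => (h.hasDerivAt_tangentialForce hd).continuousAt.continuousWithinAt) fun d hd => ?_
  rw [interior_Ioo] at hd
  rw [(h.hasDerivAt_tangentialForce hd).deriv]
  exact h.tangentialForceDeriv_neg hd

theorem tangentialForce_zero (σ A : ℝ) : tangentialForce σ A 0 = 0 := by
  simp [tangentialForce]

theorem tangentialForce_add_int_mul_two_pi (σ A d : ℝ) (k : ℤ) :
    tangentialForce σ A (d + k * (2 * π)) = tangentialForce σ A d := by
  simp [tangentialForce, cos_add_int_mul_two_pi, sin_add_int_mul_two_pi]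

theorem exists_lipschitz_tangentialForce {σ : ℝ} {A p p' : ℝ → ℝ} (hA : Continuous A)
    (hp : Continuous p) (hp' : Continuous p') (hadm : ∀ t, AdmissibleRadiusSq σ (A t))
    (hpm : ∀ t, p t ∈ Set.Ioo 0 (2 * π)) (hpm' : ∀ t, p' t ∈ Set.Ioo 0 (2 * π)) (a b : ℝ) :
    ∃ K, ∀ t ∈ Set.Icc a b, |tangentialForce σ (A t) (p' t) - tangentialForce σ (A t) (p t)| ≤
      K * |p' t - p t| := by
  have hmem : ∀ t, ∀ s ∈ Set.Icc (0 : ℝ) 1, p t + s * (p' t - p t) ∈ Set.Ioo 0 (2 * π) := by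
    intro t s hs
    have := (convex_Ioo (0 : ℝ) (2 * π)).add_smul_sub_mem (hpm t) (hpm' t) hs
    simpa using this
  have hcont : ContinuousOn (fun x : ℝ × ℝ =>
      tangentialForceDeriv σ (A x.1) (p x.1 + x.2 * (p' x.1 - p x.1)))
      (Set.Icc a b ×ˢ Set.Icc (0 : ℝ) 1) := by
    unfold tangentialForceDeriv
    refine ContinuousOn.mul (ContinuousOn.rpow_const (by fun_prop) ?_) (by fun_prop)
    intro x hx
    exact Or.inl ((hadm x.1).base_pos (hmem x.1 x.2 hx.2)).ne'
  obtain ⟨K, hK⟩ := (isCompact_Icc.prod isCompact_Icc).exists_bound_of_continuousOn hcont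
  refine ⟨K, fun t ht => ?_⟩
  have key := norm_image_sub_le_of_norm_deriv_le_segment_01'
    (f := fun s => tangentialForce σ (A t) (p t + s * (p' t - p t)))
    (f' := fun s => tangentialForceDeriv σ (A t) (p t + s * (p' t - p t)) * (p' t - p t))
    (C := K * |p' t - p t|) ?_ ?_
  · simpa using key
  · intro s hs
    have h1 : HasDerivAt (fun s => p t + s * (p' t - p t)) (p' t - p t) s := by
      simpa using ((hasDerivAt_id s).mul_const (p' t - p t)).const_add (p t)
    exact (((hadm t).hasDerivAt_tangentialForce (hmem t s hs)).comp s h1).hasDerivWithinAt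
  · intro s hs
    rw [norm_mul, norm_eq_abs (p' t - p t)]
    exact mul_le_mul_of_nonneg_right (hK (t, s) ⟨ht, hs.1, hs.2.le⟩) (abs_nonneg _)

theorem eq_zero_of_norm_deriv_le_mul_norm {E : Type*} [NormedAddCommGroup E] [NormedSpace ℝ E]
    {f f' : ℝ → E} (hf : ∀ t, HasDerivAt f (f' t) t)
    (hbound : ∀ a b, ∃ K, ∀ t ∈ Set.Icc a b, ‖f' t‖ ≤ K * ‖f t‖) {t₀ : ℝ} (h0 : f t₀ = 0)
    (t : ℝ) : f t = 0 := by
  have forward : ∀ (g g' : ℝ → E) (s₀ : ℝ), (∀ t, HasDerivAt g (g' t) t) →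
      (∀ a b, ∃ K, ∀ t ∈ Set.Icc a b, ‖g' t‖ ≤ K * ‖g t‖) → g s₀ = 0 →
      ∀ s, s₀ ≤ s → g s = 0 := by
    intro g g' s₀ hg hb hg0 s hs
    obtain ⟨K, hK⟩ := hb s₀ s
    exact eq_zero_of_abs_deriv_le_mul_abs_self_of_eq_zero_right
      (fun x _ => (hg x).continuousAt.continuousWithinAt) (fun x _ => (hg x).hasDerivWithinAt) hg0
      (fun x hx => hK x ⟨hx.1, hx.2.le⟩) s ⟨hs, le_rfl⟩
  rcases le_total t₀ t with h | h
  · exact forward f f' t₀ hf hbound h0 t h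
  · have := forward (fun s => f (-s)) (fun s => -f' (-s)) (-t₀)
      (fun s => by
        have := (hf (-s)).scomp s (hasDerivAt_neg s)
        simpa [Function.comp_def] using this)
      (fun a b => by
        obtain ⟨K, hK⟩ := hbound (-b) (-a)
        exact ⟨K, fun s hs => by
          simpa using hK (-s) ⟨by linarith [hs.2], by linarith [hs.1]⟩⟩)
      (by simpa using h0) (-t) (by linarith)
    simpa using this

theorem deriv_deriv_nonneg_of_isLocalMin {g : ℝ → ℝ} {t₀ : ℝ} (h : IsLocalMin g t₀)
    (hc : ContinuousAt g t₀) : 0 ≤ deriv (deriv g) t₀ := by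
  by_contra! hneg
  have hmax := isLocalMax_of_deriv_deriv_neg hneg h.deriv_eq_zero hc
  have hconst : g =ᶠ[nhds t₀] fun _ => g t₀ := by
    filter_upwards [h, hmax] with t h1 h2 using le_antisymm h2 h1
  rw [hconst.deriv.deriv_eq] at hneg
  simp at hneg

/-- Angles on the circle obeying the tangential equations of motion of `N` equal masses, extended
to all indices by `Θ (i + N) = Θ i + 2π`. -/
structure IsCyclicMotion (σ m : ℝ) (N : ℕ) (r : ℝ → ℝ) (Θ : ℕ → ℝ → ℝ) : Prop where
  pos : 0 < N
  mass_pos : 0 < m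
  contDiff_radius : ContDiff ℝ 2 r
  radius_pos : ∀ t, 0 < r t
  admissible : ∀ t, AdmissibleRadiusSq σ (r t ^ 2)
  contDiff_angle : ∀ i, ContDiff ℝ 2 (Θ i)
  strictMono : ∀ t, StrictMono fun i => Θ i t
  add_period : ∀ i t, Θ (i + N) t = Θ i t + 2 * π
  motion : ∀ i t, r t * deriv (deriv (Θ i)) t + 2 * deriv r t * deriv (Θ i) t =
    m * r t * ∑ k ∈ Finset.range N, tangentialForce σ (r t ^ 2) (Θ (i + k) t - Θ i t)

namespace IsCyclicMotion

variable {σ m : ℝ} {N : ℕ} {r : ℝ → ℝ} {Θ : ℕ → ℝ → ℝ}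

theorem sub_mem_Ioo (h : IsCyclicMotion σ m N r Θ) (i : ℕ) {k : ℕ} (hk : k ≠ 0) (hkN : k < N)
    (t : ℝ) : Θ (i + k) t - Θ i t ∈ Set.Ioo 0 (2 * π) := by
  have h1 : Θ i t < Θ (i + k) t := h.strictMono t (by omega)
  have h2 : Θ (i + k) t < Θ (i + N) t := h.strictMono t (by omega)
  rw [h.add_period] at h2
  exact ⟨by linarith, by linarith⟩

theorem gap_add_period (h : IsCyclicMotion σ m N r Θ) (i : ℕ) (t : ℝ) :
    Θ (i + N + 1) t - Θ (i + N) t = Θ (i + 1) t - Θ i t := by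
  rw [h.add_period, add_right_comm, h.add_period]; ring

theorem gap_mod (h : IsCyclicMotion σ m N r Θ) (i : ℕ) (t : ℝ) :
    Θ (i % N + 1) t - Θ (i % N) t = Θ (i + 1) t - Θ i t :=
  Function.Periodic.map_mod_nat (f := fun i => Θ (i + 1) t - Θ i t)
    (fun i => h.gap_add_period i t) i

theorem sum_gap (h : IsCyclicMotion σ m N r Θ) (t : ℝ) :
    ∑ j ∈ Finset.range N, (Θ (j + 1) t - Θ j t) = 2 * π := by
  rw [Finset.sum_range_sub (fun j => Θ j t)]
  have := h.add_period 0 t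
  rw [zero_add] at this
  linarith

theorem eq_of_gap_ge (h : IsCyclicMotion σ m N r Θ) {t : ℝ}
    (hgap : ∀ j < N, 2 * π / N ≤ Θ (j + 1) t - Θ j t) (i : ℕ) :
    Θ i t = Θ 0 t + 2 * π * i / N := by
  have hN : (N : ℝ) ≠ 0 := by exact_mod_cast h.pos.ne'
  have hsum : ∑ _j ∈ Finset.range N, 2 * π / N =
      ∑ j ∈ Finset.range N, (Θ (j + 1) t - Θ j t) := by
    rw [h.sum_gap, Finset.sum_const, Finset.card_range, nsmul_eq_mul]
    field_simp
  rw [Finset.sum_eq_sum_iff_of_le fun j hj => hgap j (Finset.mem_range.1 hj)] at hsum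
  induction i with
  | zero => simp
  | succ i ih =>
    have h1 := hsum (i % N) (Finset.mem_range.2 (Nat.mod_lt _ h.pos))
    rw [h.gap_mod] at h1
    have h2 : Θ (i + 1) t = Θ i t + 2 * π / N := by linarith
    rw [h2, ih]
    push_cast
    ring

theorem differentiable_angle (h : IsCyclicMotion σ m N r Θ) (i : ℕ) : Differentiable ℝ (Θ i) :=
  (h.contDiff_angle i).differentiable (by norm_num)

theorem differentiable_deriv_angle (h : IsCyclicMotion σ m N r Θ) (i : ℕ) :
    Differentiable ℝ (deriv (Θ i)) :=
  ((contDiff_succ_iff_deriv (n := 1)).1 (h.contDiff_angle i)).2.2.differentiable (by norm_num)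

theorem gap_eq_of_isLocalMin (h : IsCyclicMotion σ m N r Θ) {j : ℕ} {t : ℝ}
    (hle : ∀ i, Θ (j + 1) t - Θ j t ≤ Θ (i + 1) t - Θ i t)
    (hmin : IsLocalMin (fun s => Θ (j + 1) s - Θ j s) t) :
    Θ (j + 1) t - Θ j t = 2 * π / N := by
  have hN : (N : ℝ) ≠ 0 := by exact_mod_cast h.pos.ne'
  have hd : deriv (fun s => Θ (j + 1) s - Θ j s) =
      fun s => deriv (Θ (j + 1)) s - deriv (Θ j) s := by
    ext s
    exact deriv_fun_sub (h.differentiable_angle _ s) (h.differentiable_angle _ s)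
  have h1 := hmin.deriv_eq_zero
  have h2 := deriv_deriv_nonneg_of_isLocalMin hmin
    ((h.differentiable_angle _).sub (h.differentiable_angle _) t).continuousAt
  rw [hd] at h1 h2
  rw [deriv_fun_sub (h.differentiable_deriv_angle _ t) (h.differentiable_deriv_angle _ t)] at h2
  have hterm : ∀ k ∈ Finset.range N,
      tangentialForce σ (r t ^ 2) (Θ (j + 1 + k) t - Θ (j + 1) t) ≤
        tangentialForce σ (r t ^ 2) (Θ (j + k) t - Θ j t) := by
    intro k hk
    rcases eq_or_ne k 0 with rfl | hk0
    · simp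
    refine (h.admissible t).strictAntiOn_tangentialForce.antitoneOn
      (h.sub_mem_Ioo j hk0 (Finset.mem_range.1 hk) t)
      (h.sub_mem_Ioo (j + 1) hk0 (Finset.mem_range.1 hk) t) ?_
    have := hle (j + k)
    rw [add_right_comm j 1 k]
    linarith
  have hsum : ∑ k ∈ Finset.range N, tangentialForce σ (r t ^ 2)
        (Θ (j + 1 + k) t - Θ (j + 1) t) =
      ∑ k ∈ Finset.range N, tangentialForce σ (r t ^ 2) (Θ (j + k) t - Θ j t) := by
    refine le_antisymm (Finset.sum_le_sum hterm) ?_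
    have e1 := h.motion (j + 1) t
    have e2 := h.motion j t
    have hr := h.radius_pos t
    have : 0 ≤ m * r t * (∑ k ∈ Finset.range N, tangentialForce σ (r t ^ 2)
        (Θ (j + 1 + k) t - Θ (j + 1) t) -
        ∑ k ∈ Finset.range N, tangentialForce σ (r t ^ 2) (Θ (j + k) t - Θ j t)) := by
      rw [mul_sub, ← e1, ← e2]
      have : deriv (Θ (j + 1)) t = deriv (Θ j) t := by linarith
      rw [this]
      nlinarith
    linarith [nonneg_of_mul_nonneg_right this (mul_pos h.mass_pos hr)]
  rw [Finset.sum_eq_sum_iff_of_le hterm] at hsum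
  have hgap : ∀ k < N, Θ (j + (k + 1)) t - Θ (j + k) t = Θ (j + 1) t - Θ j t := by
    intro k hk
    rcases eq_or_ne k 0 with rfl | hk0
    · simp
    have := (h.admissible t).strictAntiOn_tangentialForce.injOn
      (h.sub_mem_Ioo (j + 1) hk0 hk t) (h.sub_mem_Ioo j hk0 hk t)
      (hsum k (Finset.mem_range.2 hk))
    rw [add_right_comm j 1 k, add_assoc j k 1] at this
    linarith
  have htel : ∑ k ∈ Finset.range N, (Θ (j + (k + 1)) t - Θ (j + k) t) = 2 * π := by
    rw [Finset.sum_range_sub (fun k => Θ (j + k) t), h.add_period]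
    simp
  rw [Finset.sum_congr rfl fun k hk => hgap k (Finset.mem_range.1 hk), Finset.sum_const,
    Finset.card_range, nsmul_eq_mul] at htel
  field_simp
  linarith

/-- The deviation of the `i`-th angle from the regular polygon through the zeroth one. -/
noncomputable def deviation (Θ : ℕ → ℝ → ℝ) (N i : ℕ) (t : ℝ) : ℝ :=
  Θ i t - Θ 0 t - 2 * π * i / N

theorem deviation_mod (h : IsCyclicMotion σ m N r Θ) (i : ℕ) (t : ℝ) :
    deviation Θ N (i % N) t = deviation Θ N i t := by
  have hN : (N : ℝ) ≠ 0 := by exact_mod_cast h.pos.ne'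
  refine Function.Periodic.map_mod_nat (f := fun i => deviation Θ N i t) (fun i => ?_) i
  simp only [deviation, h.add_period]
  push_cast
  field_simp
  ring

theorem exists_bound_force_sub (h : IsCyclicMotion σ m N r Θ) (i k : ℕ) (hk : k < N) (a b : ℝ) :
    ∃ K, 0 ≤ K ∧ ∀ t ∈ Set.Icc a b, ∀ x, (∀ l, |deviation Θ N l t| ≤ x) →
      |tangentialForce σ (r t ^ 2) (Θ (i + k) t - Θ i t) -
        tangentialForce σ (r t ^ 2) (Θ (0 + k) t - Θ 0 t)| ≤ K * x := by
  have hN : (N : ℝ) ≠ 0 := by exact_mod_cast h.pos.ne'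
  rcases eq_or_ne k 0 with rfl | hk0
  · exact ⟨0, le_rfl, fun t _ x _ => by simp⟩
  have hc := fun i => (h.contDiff_angle i).continuous
  obtain ⟨K, hK⟩ := exists_lipschitz_tangentialForce (σ := σ) (h.contDiff_radius.continuous.pow 2)
    ((hc (0 + k)).sub (hc 0)) ((hc (i + k)).sub (hc i)) h.admissible (h.sub_mem_Ioo 0 hk0 hk)
    (h.sub_mem_Ioo i hk0 hk) a b
  refine ⟨|K| * 3, by positivity, fun t ht x hx => (hK t ht).trans ?_⟩
  have e : (Θ (i + k) t - Θ i t) - (Θ (0 + k) t - Θ 0 t) =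
      deviation Θ N (i + k) t - deviation Θ N i t - deviation Θ N k t := by
    simp only [deviation, zero_add]
    push_cast
    field_simp
    ring
  simp only [Pi.sub_apply]
  rw [e, mul_assoc]
  refine mul_le_mul (le_abs_self K) ?_ (abs_nonneg _) (abs_nonneg _)
  have h1 := abs_le.1 (hx (i + k))
  have h2 := abs_le.1 (hx i)
  have h3 := abs_le.1 (hx k)
  exact abs_le.2 ⟨by linarith, by linarith⟩

theorem regular_of_eventually (h : IsCyclicMotion σ m N r Θ) {t₀ : ℝ}
    (h0 : ∀ᶠ t in nhds t₀, ∀ i, Θ i t = Θ 0 t + 2 * π * i / N) (t : ℝ) (i : ℕ) :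
    Θ i t = Θ 0 t + 2 * π * i / N := by
  have hdev : ∀ i t, HasDerivAt (deviation Θ N i) (deriv (Θ i) t - deriv (Θ 0) t) t := fun i t =>
    (((h.differentiable_angle i t).hasDerivAt).sub
      ((h.differentiable_angle 0 t).hasDerivAt)).sub_const _
  let f : ℝ → Fin N → ℝ × ℝ := fun t i => (deviation Θ N i t, deriv (Θ i) t - deriv (Θ 0) t)
  let f' : ℝ → Fin N → ℝ × ℝ := fun t i =>
    (deriv (Θ i) t - deriv (Θ 0) t, deriv (deriv (Θ i)) t - deriv (deriv (Θ 0)) t)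
  have hf : ∀ t, HasDerivAt f (f' t) t := fun t => hasDerivAt_pi.2 fun i =>
    (hdev i t).prodMk (((h.differentiable_deriv_angle i t).hasDerivAt).sub
      ((h.differentiable_deriv_angle 0 t).hasDerivAt))
  have hf1 : ∀ t l, |deviation Θ N l t| ≤ ‖f t‖ := fun t l => by
    rw [← h.deviation_mod]
    exact (norm_fst_le (f t ⟨l % N, Nat.mod_lt _ h.pos⟩)).trans (norm_le_pi_norm (f t) _)
  have hf2 : ∀ t (l : Fin N), |deriv (Θ l) t - deriv (Θ 0) t| ≤ ‖f t‖ := fun t l =>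
    (norm_snd_le (f t l)).trans (norm_le_pi_norm (f t) l)
  have hr := h.contDiff_radius.continuous
  have hr' : Continuous (deriv r) := h.contDiff_radius.continuous_deriv (by norm_num)
  have hbound : ∀ a b, ∃ K, ∀ t ∈ Set.Icc a b, ‖f' t‖ ≤ K * ‖f t‖ := by
    intro a b
    obtain ⟨C, hC⟩ := (isCompact_Icc (a := a) (b := b)).exists_bound_of_continuousOn
      (f := fun t => 2 * deriv r t / r t)
      ((continuous_const.mul hr').div hr fun t => (h.radius_pos t).ne').continuousOn
    choose K hK0 hK using fun (i : ℕ) (k : Fin N) => h.exists_bound_force_sub i k k.2 a b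
    let L : ℕ → ℝ := fun i => ∑ k : Fin N, K i k
    have hL : ∀ i, 0 ≤ L i := fun i => Finset.sum_nonneg fun k _ => hK0 i k
    have hL' : ∀ i : Fin N, L i ≤ ∑ j : Fin N, L j := fun i =>
      Finset.single_le_sum (f := fun j : Fin N => L j) (fun j _ => hL j) (Finset.mem_univ i)
    have hLs : 0 ≤ ∑ j : Fin N, L j := Finset.sum_nonneg fun j _ => hL j
    refine ⟨1 + |C| + m * ∑ j : Fin N, L j, fun t ht => ?_⟩
    have hm := h.mass_pos
    have hmL : 0 ≤ m * ∑ j : Fin N, L j := mul_nonneg hm.le hLs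
    refine (pi_norm_le_iff_of_nonneg (by positivity)).2 fun i => ?_
    refine norm_prod_le_iff.2 ⟨(hf2 t i).trans ?_, ?_⟩
    · nlinarith [norm_nonneg (f t), abs_nonneg C]
    have hrt := (h.radius_pos t).ne'
    have e : deriv (deriv (Θ i)) t - deriv (deriv (Θ 0)) t =
        -(2 * deriv r t / r t * (deriv (Θ i) t - deriv (Θ 0) t)) +
        m * ∑ k : Fin N, (tangentialForce σ (r t ^ 2) (Θ (i + k) t - Θ i t) -
          tangentialForce σ (r t ^ 2) (Θ (0 + k) t - Θ 0 t)) := by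
      have e1 := h.motion i t
      have e2 := h.motion 0 t
      rw [Finset.sum_range] at e1 e2
      rw [Finset.sum_sub_distrib]
      field_simp
      linear_combination e1 - e2
    have hsum : |∑ k : Fin N, (tangentialForce σ (r t ^ 2) (Θ (i + k) t - Θ i t) -
          tangentialForce σ (r t ^ 2) (Θ (0 + k) t - Θ 0 t))| ≤ (∑ j : Fin N, L j) * ‖f t‖ := by
      refine (Finset.abs_sum_le_sum_abs _ _).trans ?_
      refine (Finset.sum_le_sum fun k _ => hK i k t ht _ (hf1 t)).trans ?_
      rw [← Finset.sum_mul]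
      exact mul_le_mul_of_nonneg_right (hL' i) (norm_nonneg _)
    simp only [f', e, norm_eq_abs]
    have h1 : |2 * deriv r t / r t * (deriv (Θ i) t - deriv (Θ 0) t)| ≤ |C| * ‖f t‖ := by
      rw [abs_mul]
      exact mul_le_mul ((hC t ht).trans (le_abs_self C)) (hf2 t i) (abs_nonneg _) (abs_nonneg _)
    refine (abs_add_le _ _).trans ?_
    rw [abs_neg, abs_mul m, abs_of_pos hm]
    have h2 := mul_le_mul_of_nonneg_left hsum hm.le
    nlinarith [norm_nonneg (f t)]
  have hf0 : f t₀ = 0 := by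
    ext i
    · have := h0.self_of_nhds i
      simp only [f, deviation, Pi.zero_apply, Prod.fst_zero]
      linarith
    · simp only [f, Pi.zero_apply, Prod.snd_zero]
      rw [← (hdev i t₀).deriv]
      have : deviation Θ N i =ᶠ[nhds t₀] fun _ => 0 := by
        filter_upwards [h0] with s hs
        have := hs i
        simp only [deviation]
        linarith
      rw [this.deriv_eq]
      simp
  have hz := eq_zero_of_norm_deriv_le_mul_norm hf hbound hf0 t
  have := hf1 t i
  rw [hz, norm_zero] at this
  have := abs_nonpos_iff.1 this
  simp only [deviation] at this
  linarith

theorem regular_of_isLocalMin (h : IsCyclicMotion σ m N r Θ) (hne : (Finset.range N).Nonempty)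
    {t₀ : ℝ} (hmin : IsLocalMin
      (fun t => (Finset.range N).inf' hne fun j => Θ (j + 1) t - Θ j t) t₀) (t : ℝ) (i : ℕ) :
    Θ i t = Θ 0 t + 2 * π * i / N := by
  obtain ⟨j, hj, hje⟩ := Finset.exists_mem_eq_inf' hne fun j => Θ (j + 1) t₀ - Θ j t₀
  have hgap : Θ (j + 1) t₀ - Θ j t₀ = 2 * π / N := by
    refine h.gap_eq_of_isLocalMin (fun i => ?_) ?_
    · rw [← hje, ← h.gap_mod i]
      exact Finset.inf'_le (fun j => Θ (j + 1) t₀ - Θ j t₀)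
        (Finset.mem_range.2 (Nat.mod_lt i h.pos))
    · filter_upwards [hmin] with s hs
      rw [← hje]
      exact hs.trans (Finset.inf'_le (fun j => Θ (j + 1) s - Θ j s) hj)
  refine h.regular_of_eventually (t₀ := t₀) ?_ t i
  filter_upwards [hmin] with s hs
  refine h.eq_of_gap_ge fun l hl => ?_
  rw [← hgap, ← hje]
  exact hs.trans (Finset.inf'_le (fun j => Θ (j + 1) s - Θ j s) (Finset.mem_range.2 hl))

end IsCyclicMotion

theorem Function.Periodic.sum_range_add {M : Type*} [AddCommGroup M] {f : ℕ → M} {N : ℕ}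
    (hf : Function.Periodic f N) (i : ℕ) :
    ∑ k ∈ Finset.range N, f (i + k) = ∑ k ∈ Finset.range N, f k := by
  induction i with
  | zero => simp
  | succ i ih =>
    have h1 := Finset.sum_range_succ (fun k => f (i + k)) N
    rw [Finset.sum_range_succ' (fun k => f (i + k)) N, hf i, add_zero] at h1
    rw [← ih, ← add_right_cancel h1]
    exact Finset.sum_congr rfl fun k _ => by rw [add_right_comm, add_assoc]

/-- Extension of `N` angles to all indices, turning once around the circle every `N` steps. -/
noncomputable def liftAngle (N : ℕ) (θ : ℕ → ℝ → ℝ) (i : ℕ) (t : ℝ) : ℝ :=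
  θ (i % N) t + 2 * π * (i / N : ℕ)

theorem liftAngle_of_lt {N : ℕ} (θ : ℕ → ℝ → ℝ) {i : ℕ} (hi : i < N) :
    liftAngle N θ i = θ i := by
  ext t
  simp [liftAngle, Nat.mod_eq_of_lt hi, Nat.div_eq_of_lt hi]

theorem liftAngle_add_period {N : ℕ} (hN : 0 < N) (θ : ℕ → ℝ → ℝ) (i : ℕ) (t : ℝ) :
    liftAngle N θ (i + N) t = liftAngle N θ i t + 2 * π := by
  simp only [liftAngle, Nat.add_mod_right, Nat.add_div_right i hN]
  push_cast
  ring

theorem strictMono_liftAngle {N : ℕ} (hN : 0 < N) {θ : ℕ → ℝ → ℝ} {t : ℝ}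
    (hord : ∀ i j, i < j → j < N → θ i t < θ j t) (hord2 : ∀ i < N, θ i t < θ 0 t + 2 * π) :
    StrictMono fun i => liftAngle N θ i t := by
  refine strictMono_nat_of_lt_succ fun i => ?_
  have hi := Nat.mod_lt i hN
  have hdm := Nat.div_add_mod i N
  rcases Nat.lt_or_ge (i % N + 1) N with h | h
  · have h1 : (i + 1) % N = i % N + 1 := by
      have h3 : 1 % N = 1 := Nat.mod_eq_of_lt (by omega)
      rw [Nat.add_mod_of_add_mod_lt (by rwa [h3]), h3]
    have h2 : (i + 1) / N = i / N := by
      rw [Nat.div_eq_iff hN]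
      rw [mul_comm] at hdm
      omega
    simp only [liftAngle, h1, h2]
    linarith [hord _ _ (Nat.lt_succ_self (i % N)) h]
  · have h0 : i + 1 = N * (i / N + 1) := by rw [mul_add]; omega
    have h1 : (i + 1) % N = 0 := by rw [h0, Nat.mul_mod_right]
    have h2 : (i + 1) / N = i / N + 1 := by rw [h0, Nat.mul_div_cancel_left _ hN]
    simp only [liftAngle, h1, h2]
    push_cast
    linarith [hord2 _ hi]

theorem tangentialForce_liftAngle_sub (σ A : ℝ) (N : ℕ) (θ : ℕ → ℝ → ℝ) (i j : ℕ) (t : ℝ) :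
    tangentialForce σ A (liftAngle N θ j t - liftAngle N θ i t) =
      tangentialForce σ A (θ (j % N) t - θ (i % N) t) := by
  have e : liftAngle N θ j t - liftAngle N θ i t = θ (j % N) t - θ (i % N) t +
      (((j / N : ℕ) : ℤ) - ((i / N : ℕ) : ℤ) : ℤ) * (2 * π) := by
    simp only [liftAngle, Int.cast_sub, Int.cast_natCast]
    ring
  rw [e, tangentialForce_add_int_mul_two_pi]

theorem sum_tangentialForce_liftAngle (σ A : ℝ) (N : ℕ) (θ : ℕ → ℝ → ℝ) (i : ℕ)
    (t : ℝ) :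
    ∑ k ∈ Finset.range N, tangentialForce σ A (liftAngle N θ (i + k) t - liftAngle N θ i t) =
      ∑ j ∈ (Finset.range N).erase (i % N), tangentialForce σ A (θ j t - θ (i % N) t) := by
  simp only [tangentialForce_liftAngle_sub]
  rw [Function.Periodic.sum_range_add
    (f := fun j => tangentialForce σ A (θ (j % N) t - θ (i % N) t)) (fun j => by simp) i,
    Finset.sum_erase _ (by simp [tangentialForce_zero])]
  exact Finset.sum_congr rfl fun j hj => by rw [Nat.mod_eq_of_lt (Finset.mem_range.1 hj)]

/-- The tangential part of the second derivative of a curve in cylindrical coordinates. -/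
theorem tangential_deriv_deriv {r z θ : ℝ → ℝ} (hr : ContDiff ℝ 2 r) (hz : ContDiff ℝ 2 z)
    (hθ : ContDiff ℝ 2 θ) {q : ℝ → ℝ × ℝ × ℝ}
    (hq : ∀ t, q t = (r t * cos (θ t), r t * sin (θ t), z t)) (t : ℝ) :
    -sin (θ t) * (deriv (deriv q) t).1 + cos (θ t) * (deriv (deriv q) t).2.1 =
      r t * deriv (deriv θ) t + 2 * deriv r t * deriv θ t := by
  have d1 : ∀ {f : ℝ → ℝ}, ContDiff ℝ 2 f → ∀ s, HasDerivAt f (deriv f s) s := fun hf s =>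
    (hf.differentiable (by norm_num) s).hasDerivAt
  have d2 : ∀ {f : ℝ → ℝ}, ContDiff ℝ 2 f → HasDerivAt (deriv f) (deriv (deriv f) t) t :=
    fun hf => (((contDiff_succ_iff_deriv (n := 1)).1 hf).2.2.differentiable
      (by norm_num) t).hasDerivAt
  have hq1 : deriv q = fun s => (deriv r s * cos (θ s) + r s * (-sin (θ s) * deriv θ s),
      deriv r s * sin (θ s) + r s * (cos (θ s) * deriv θ s), deriv z s) := by
    ext1 s
    rw [funext hq]
    exact (((d1 hr s).mul (d1 hθ s).cos).prodMk
      (((d1 hr s).mul (d1 hθ s).sin).prodMk (d1 hz s))).deriv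
  have hc := (d1 hθ t).cos
  have hs := (d1 hθ t).sin
  have hq2 := ((((d2 hr).mul hc).add ((d1 hr t).mul (hs.neg.mul (d2 hθ)))).prodMk
    ((((d2 hr).mul hs).add ((d1 hr t).mul (hc.mul (d2 hθ)))).prodMk (d2 hz))).deriv
  have hq3 : deriv (deriv q) t = _ := (congrArg (fun f => deriv f t) hq1).trans hq2
  rw [hq3]
  simp only [Pi.neg_apply, Pi.mul_apply]
  linear_combination (r t * deriv (deriv θ) t + 2 * deriv r t * deriv θ t) *
    sin_sq_add_cos_sq (θ t)

theorem tangential_motion {N : ℕ} {σ m : ℝ} (hσ : σ = 1 ∨ σ = -1)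
    {mass : ℕ → ℝ} (hmass : ∀ i < N, mass i = m)
    {r z : ℝ → ℝ} (hr : ContDiff ℝ 2 r) (hz : ContDiff ℝ 2 z)
    (hsphere : ∀ t, r t ^ 2 + σ * z t ^ 2 = σ)
    {θ : ℕ → ℝ → ℝ} (hθ : ∀ i < N, ContDiff ℝ 2 (θ i)) {q : ℕ → ℝ → ℝ × ℝ × ℝ}
    (hq : ∀ i < N, ∀ t, q i t = (r t * cos (θ i t), r t * sin (θ i t), z t))
    (hqN : ∀ t, q N t = (0, 0, 1)) {i : ℕ} (hi : i < N) {t : ℝ}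
    (hODE : deriv (deriv (q i)) t =
      (∑ j ∈ (Finset.range (N + 1)).erase i,
        (mass j * (σ - σ * (odot σ (q i t) (q j t)) ^ 2) ^ (-(3 / 2 : ℝ))) •
          (q j t - (σ * odot σ (q i t) (q j t)) • q i t))
      - (σ * odot σ (deriv (q i) t) (deriv (q i) t)) • q i t) :
    r t * deriv (deriv (θ i)) t + 2 * deriv r t * deriv (θ i) t =
      m * r t * ∑ j ∈ (Finset.range N).erase i,
        tangentialForce σ (r t ^ 2) (θ j t - θ i t) := by
  rw [← tangential_deriv_deriv hr hz (hθ i hi) (hq i hi) t, hODE]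
  let T : ℝ × ℝ × ℝ →ₗ[ℝ] ℝ :=
    -sin (θ i t) • LinearMap.fst ℝ ℝ (ℝ × ℝ) +
      cos (θ i t) • (LinearMap.fst ℝ ℝ ℝ ∘ₗ LinearMap.snd ℝ ℝ (ℝ × ℝ))
  have hT : ∀ v, -sin (θ i t) * v.1 + cos (θ i t) * v.2.1 = T v := fun v => by simp [T]
  have hTi : T (q i t) = 0 := by
    rw [← hT, hq i hi]
    ring
  have hTN : T (q N t) = 0 := by
    rw [← hT, hqN]
    simp
  rw [hT, map_sub, map_smul, hTi, smul_zero, sub_zero, map_sum, Finset.range_add_one,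
    Finset.erase_insert_of_ne hi.ne', Finset.sum_insert (by simp)]
  simp only [map_smul, map_sub, hTi, hTN, smul_zero, sub_zero, zero_add]
  rw [Finset.mul_sum]
  refine Finset.sum_congr rfl fun j hj => ?_
  have hj' : j < N := Finset.mem_range.1 (Finset.mem_of_mem_erase hj)
  rw [hmass j hj', ← hT, hq i hi, hq j hj']
  have hbase : σ - σ * odot σ (r t * cos (θ i t), r t * sin (θ i t), z t)
      (r t * cos (θ j t), r t * sin (θ j t), z t) ^ 2 =
      r t ^ 2 * (1 - cos (θ j t - θ i t)) *
        (2 - σ * (r t ^ 2 * (1 - cos (θ j t - θ i t)))) := by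
    have hod : odot σ (r t * cos (θ i t), r t * sin (θ i t), z t)
        (r t * cos (θ j t), r t * sin (θ j t), z t) =
        σ - r t ^ 2 * (1 - cos (θ j t - θ i t)) := by
      rw [cos_sub]
      simp only [odot]
      linear_combination hsphere t
    rw [hod]
    rcases hσ with rfl | rfl <;> ring
  rw [hbase, tangentialForce, smul_eq_mul, sin_sub]
  ring

/-- A solution of the curved `n`-body problem on `M_σ²` of centered circular
type (`n-1` bodies on a circle, one body fixed at the pole `(0,0,1)`), in which the
circling masses are all equal to a constant `m > 0` and the central mass `M > 0` is
arbitrary, with `σ = -1`, or `σ = 1` and `r < √10/5`, whose minimal angular gap `μ₂` has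
a local minimum at some time `t₀`, has its `n-1` circling bodies forming a polygonal
rotopulsator with a regular polygon configuration.
Bodies on the circle are indexed by `i ∈ {0, …, n-2}`; the central body is body `n-1`. -/
theorem curved_centered_circular_equal_masses_is_regular_rotopulsator
    (n : ℕ) (hn : 3 ≤ n)
    (σ : ℝ) (hσ : σ = 1 ∨ σ = -1)
    -- the common mass of the circling bodies and the central mass
    (m M : ℝ) (hm : 0 < m) (hM : 0 < M)
    -- masses in order: bodies `0,…,n-2` have mass `m`, body `n-1` has mass `M`
    (mass : ℕ → ℝ) (hmass : ∀ i < n - 1, mass i = m) (hmassn : mass (n - 1) = M)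
    -- the radius, twice continuously differentiable and positive
    (r : ℝ → ℝ) (hr : ContDiff ℝ 2 r) (hr_pos : ∀ t, 0 < r t)
    -- the third coordinate, twice continuously differentiable, with `r² + σz² = σ`
    (z : ℝ → ℝ) (hz : ContDiff ℝ 2 z) (hsphere : ∀ t, r t ^ 2 + σ * z t ^ 2 = σ)
    -- either `σ = -1`, or `σ = 1` and `r < √10/5` everywhere
    (hcase : σ = -1 ∨ (σ = 1 ∧ ∀ t, r t < Real.sqrt 10 / 5))
    -- the angles, twice continuously differentiable and ordered
    (θ : ℕ → ℝ → ℝ) (hθ : ∀ i < n - 1, ContDiff ℝ 2 (θ i))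
    (hord : ∀ t, ∀ i j, i < j → j < n - 1 → θ i t < θ j t)
    (hord2 : ∀ t, ∀ i < n - 1, θ i t < θ 0 t + 2 * π)
    -- the bodies: `n-1` of them on a circle of radius `r` at height `z`, one at the pole
    (q : ℕ → ℝ → ℝ × ℝ × ℝ)
    (hq : ∀ i < n - 1, ∀ t,
      q i t = (r t * Real.cos (θ i t), r t * Real.sin (θ i t), z t))
    (hqn : ∀ t, q (n - 1) t = (0, 0, 1))
    -- the curved equations of motion
    (hODE : ∀ i < n, ∀ t, deriv (deriv (q i)) t =
      (∑ j ∈ (Finset.range n).erase i,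
        (mass j * (σ - σ * (odot σ (q i t) (q j t)) ^ 2) ^ (-(3 / 2 : ℝ))) •
          (q j t - (σ * odot σ (q i t) (q j t)) • q i t))
      - (σ * odot σ (deriv (q i) t) (deriv (q i) t)) • q i t)
    -- `μ₂` has a local minimum at `t₀`
    (t₀ : ℝ)
    (hmin : IsLocalMin (fun t =>
      (Finset.range (n - 1)).inf' (Finset.nonempty_range_iff.mpr (by omega))
        (fun j => (if j + 1 = n - 1 then θ 0 t + 2 * π else θ (j + 1) t) - θ j t)) t₀) :
    -- conclusion: the circling bodies form a regular polygonal rotopulsator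
    ∃ φ : ℝ → ℝ, ContDiff ℝ 2 φ ∧
      ∀ i < n - 1, ∀ t, θ i t = φ t + 2 * π * i / (n - 1) := by
  obtain ⟨N, rfl⟩ : ∃ N, n = N + 1 := ⟨n - 1, by omega⟩
  simp only [Nat.add_sub_cancel] at *
  have hN : 0 < N := by omega
  have hadm : ∀ t, AdmissibleRadiusSq σ (r t ^ 2) := fun t => by
    refine ⟨pow_pos (hr_pos t) 2, hcase.imp_right fun h => ⟨h.1, ?_⟩⟩
    have h1 := pow_lt_pow_left₀ (h.2 t) (hr_pos t).le two_ne_zero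
    rw [div_pow, Real.sq_sqrt (by norm_num)] at h1
    linarith
  have hder : ∀ i, deriv (liftAngle N θ i) = deriv (θ (i % N)) := fun i => by
    ext t
    exact deriv_add_const _
  have h : IsCyclicMotion σ m N r (liftAngle N θ) :=
    { pos := hN
      mass_pos := hm
      contDiff_radius := hr
      radius_pos := hr_pos
      admissible := hadm
      contDiff_angle := fun i => (hθ _ (Nat.mod_lt i hN)).add contDiff_const
      strictMono := fun t => strictMono_liftAngle hN (hord t) (hord2 t)
      add_period := liftAngle_add_period hN θ
      motion := fun i t => by
        have hi := Nat.mod_lt i hN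
        rw [hder, sum_tangentialForce_liftAngle]
        exact tangential_motion hσ hmass hr hz hsphere hθ hq hqn hi (hODE _ (by omega) t) }
  have hne : (Finset.range N).Nonempty := Finset.nonempty_range_iff.2 hN.ne'
  have hgap : (fun t => (Finset.range N).inf' hne
      fun j => (if j + 1 = N then θ 0 t + 2 * π else θ (j + 1) t) - θ j t) =
      fun t => (Finset.range N).inf' hne
        fun j => liftAngle N θ (j + 1) t - liftAngle N θ j t := by
    ext t
    refine Finset.inf'_congr hne rfl fun j hj => ?_
    have hj' := Finset.mem_range.1 hj
    rw [liftAngle_of_lt θ hj']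
    split_ifs with hjN
    · have := liftAngle_add_period hN θ 0 t
      rw [zero_add, liftAngle_of_lt θ hN] at this
      rw [hjN, this]
    · rw [liftAngle_of_lt θ (by omega)]
  rw [hgap] at hmin
  refine ⟨θ 0, hθ 0 hN, fun i hi t => ?_⟩
  have key := h.regular_of_isLocalMin hne hmin t i
  rw [liftAngle_of_lt θ hi, liftAngle_of_lt θ hN] at key
  rw [key]
  push_cast
  ring
end

section
/- Let n ≥ 2 and let q_1,…,q_n be a polygonal homographic orbit solution of the planar n-body system with regular polygon configuration α_i = 2πi/n and with all masses equal to a single everywhere-positive function m : ℝ → ℝ. Then there exists a constant a ∈ ℝ such that for all t: φ'(t) = a/r(t)² and m(t) = (a² − r''(t)·r(t)³) / ( r(t)⁴ · Σ_{j=1}^{n−1} (1 − cos(2πj/n)) · f(2r(t)²(1 − cos(2πj/n))) ). -/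
open Real

/-- A twice differentiable planar curve in polar form splits its acceleration into a radial and a
transverse part. -/
lemma deriv_deriv_polar {r φ : ℝ → ℝ} (hr : ContDiff ℝ 2 r) (hφ : ContDiff ℝ 2 φ) (t : ℝ) :
    deriv (deriv fun t => (r t * cos (φ t), r t * sin (φ t))) t =
      ((deriv (deriv r) t - r t * deriv φ t ^ 2) * cos (φ t) -
          (2 * deriv r t * deriv φ t + r t * deriv (deriv φ) t) * sin (φ t),
        (deriv (deriv r) t - r t * deriv φ t ^ 2) * sin (φ t) +
          (2 * deriv r t * deriv φ t + r t * deriv (deriv φ) t) * cos (φ t)) := by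
  have hr1 (s : ℝ) : HasDerivAt r (deriv r s) s :=
    (hr.differentiable two_ne_zero s).hasDerivAt
  have hφ1 (s : ℝ) : HasDerivAt φ (deriv φ s) s :=
    (hφ.differentiable two_ne_zero s).hasDerivAt
  have hr2 : HasDerivAt (deriv r) (deriv (deriv r) t) t :=
    (hr.differentiable_deriv_two t).hasDerivAt
  have hφ2 : HasDerivAt (deriv φ) (deriv (deriv φ) t) t :=
    (hφ.differentiable_deriv_two t).hasDerivAt
  have hvel : (deriv fun t => (r t * cos (φ t), r t * sin (φ t))) = fun s =>
      (deriv r s * cos (φ s) + r s * (-sin (φ s) * deriv φ s),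
        deriv r s * sin (φ s) + r s * (cos (φ s) * deriv φ s)) :=
    funext fun s => (((hr1 s).mul (hφ1 s).cos).prodMk ((hr1 s).mul (hφ1 s).sin)).deriv
  rw [hvel]
  have hx := (hr2.mul (hφ1 t).cos).add ((hr1 t).mul ((hφ1 t).sin.neg.mul hφ2))
  have hy := (hr2.mul (hφ1 t).sin).add ((hr1 t).mul ((hφ1 t).cos.mul hφ2))
  refine (hx.prodMk hy).deriv.trans (Prod.ext ?_ ?_) <;>
    simp only [Pi.neg_apply, Pi.mul_apply] <;> ring

/-- Sums of `sin` over the nontrivial `n`-th angles of the circle vanish when weighted by a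
function of `cos`. -/
lemma sum_comp_cos_mul_sin_eq_zero (n : ℕ) (hn : n ≠ 0) (g : ℝ → ℝ) :
    ∑ j ∈ Finset.Icc 1 (n - 1), g (cos (2 * π * j / n)) * sin (2 * π * j / n) = 0 := by
  have hneg : ∑ j ∈ Finset.Icc 1 (n - 1), g (cos (2 * π * j / n)) * sin (2 * π * j / n) =
      ∑ j ∈ Finset.Icc 1 (n - 1), -(g (cos (2 * π * j / n)) * sin (2 * π * j / n)) := by
    refine Finset.sum_nbij' (n - ·) (n - ·) ?_ ?_ ?_ ?_ fun j hj => ?_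
    any_goals (intro j hj; simp only [Finset.mem_Icc] at hj ⊢; omega)
    have hjn : j ≤ n := by have := Finset.mem_Icc.mp hj; omega
    have hangle : 2 * π * ((n - j : ℕ) : ℝ) / n = 2 * π - 2 * π * j / n := by
      rw [Nat.cast_sub hjn]
      field_simp
    rw [hangle, cos_two_pi_sub, sin_two_pi_sub]
    ring
  rw [Finset.sum_neg_distrib] at hneg
  linarith

/-- The cosine of a nontrivial `n`-th angle of the circle is less than one. -/
lemma cos_two_pi_mul_div_lt_one {n j : ℕ} (hj : 0 < j) (hjn : j < n) :
    cos (2 * π * j / n) < 1 := by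
  have hn : (0 : ℝ) < n := by exact_mod_cast hj.trans hjn
  have hj' : (0 : ℝ) < j := by exact_mod_cast hj
  have hlt : 2 * π * j / n < 2 * π := by
    rw [div_lt_iff₀ hn]
    exact mul_lt_mul_of_pos_left (by exact_mod_cast hjn) two_pi_pos
  have hpos : 0 < 2 * π * j / n := by positivity
  refine (cos_le_one _).lt_of_ne fun h => hpos.ne' ?_
  exact (cos_eq_one_iff_of_lt_of_lt (by linarith [two_pi_pos]) hlt).mp h


/-- For a polygonal homographic orbit solution of the planar `n`-body
problem with regular polygon configuration `α_i = 2πi/n` (here bodies are indexed by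
`i ∈ {0, …, n-1}` with phases `α i = 2π(i+1)/n`) and all masses equal to a single
everywhere-positive function `m`, there is a constant `a` such that `φ' = a/r²` and
`m = (a² − r''r³) / (r⁴ Σ_{j=1}^{n-1} (1 − cos(2πj/n)) f(2r²(1 − cos(2πj/n))))`. -/
theorem homographic_regular_mass_formula
    (n : ℕ) (hn : 2 ≤ n)
    -- the kernel `f`: positive on `(0,∞)`, with `x ↦ √x · f x` decreasing on `(0,∞)`
    (f : ℝ → ℝ) (hf_pos : ∀ x > 0, 0 < f x)
    (hf_dec : AntitoneOn (fun x => Real.sqrt x * f x) (Set.Ioi 0))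
    -- the common mass function, everywhere positive
    (m : ℝ → ℝ) (hm : ∀ t, 0 < m t)
    -- the radius, twice continuously differentiable and positive
    (r : ℝ → ℝ) (hr : ContDiff ℝ 2 r) (hr_pos : ∀ t, 0 < r t)
    -- the common rotation angle, twice continuously differentiable
    (φ : ℝ → ℝ) (hφ : ContDiff ℝ 2 φ)
    -- the constant phases: regular polygon configuration `α_i = 2πi/n`, `i = 1,…,n`
    (α : ℕ → ℝ) (hα : ∀ i < n, α i = 2 * π * (i + 1) / n)
    -- the bodies
    (q : ℕ → ℝ → ℝ × ℝ)
    (hq : ∀ i < n, ∀ t,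
      q i t = (r t * Real.cos (φ t + α i), r t * Real.sin (φ t + α i)))
    -- the equations of motion
    (hODE : ∀ i < n, ∀ t, deriv (deriv (q i)) t =
      ∑ j ∈ (Finset.range n).erase i,
        (m t * f (((q j t).1 - (q i t).1) ^ 2 + ((q j t).2 - (q i t).2) ^ 2)) •
          (q j t - q i t)) :
    -- conclusion
    ∃ a : ℝ, ∀ t,
      deriv φ t = a / r t ^ 2 ∧
      m t = (a ^ 2 - deriv (deriv r) t * r t ^ 3) /
        (r t ^ 4 * ∑ j ∈ Finset.Icc 1 (n - 1),
          (1 - Real.cos (2 * π * j / n)) *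
            f (2 * r t ^ 2 * (1 - Real.cos (2 * π * j / n)))) := by
  have hlast : n - 1 < n := by omega
  have hα_last : α (n - 1) = 2 * π := by
    rw [hα _ hlast, Nat.cast_sub (by omega)]
    field_simp
    simp
  have hq_last : q (n - 1) = fun t => (r t * cos (φ t), r t * sin (φ t)) := by
    ext1 t
    rw [hq _ hlast, hα_last, cos_add_two_pi, sin_add_two_pi]
  have hmotion (t : ℝ) : deriv (deriv (q (n - 1))) t = ∑ j ∈ Finset.Icc 1 (n - 1),
      (m t * f (2 * r t ^ 2 * (1 - cos (2 * π * j / n)))) •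
        ((r t * cos (φ t + 2 * π * j / n), r t * sin (φ t + 2 * π * j / n)) -
          (r t * cos (φ t), r t * sin (φ t))) := by
    rw [hODE _ hlast]
    refine Finset.sum_nbij' (· + 1) (· - 1) ?_ ?_ ?_ ?_ fun j hj => ?_
    any_goals
      intro j hj
      simp only [Finset.mem_Icc, Finset.mem_erase, Finset.mem_range] at hj ⊢
      omega
    have hjn : j < n := Finset.mem_range.mp (Finset.mem_of_mem_erase hj)
    rw [hq_last, hq j hjn, hα j hjn]
    push_cast
    congr 3
    rw [cos_add, sin_add]
    generalize 2 * π * ((j : ℝ) + 1) / n = θ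
    linear_combination (r t ^ 2 * (1 + cos θ ^ 2 + sin θ ^ 2 - 2 * cos θ)) *
      sin_sq_add_cos_sq (φ t) + r t ^ 2 * sin_sq_add_cos_sq θ
  set S : ℝ → ℝ := fun t => ∑ j ∈ Finset.Icc 1 (n - 1),
    (1 - cos (2 * π * j / n)) * f (2 * r t ^ 2 * (1 - cos (2 * π * j / n))) with hS
  have hS_pos (t : ℝ) : 0 < S t := by
    refine Finset.sum_pos (fun j hj => ?_) ⟨1, by simp; omega⟩
    have hj' := Finset.mem_Icc.mp hj
    have hcos : 0 < 1 - cos (2 * π * j / n) :=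
      sub_pos.mpr (cos_two_pi_mul_div_lt_one (by omega) (by omega))
    have hrt := hr_pos t
    exact mul_pos hcos (hf_pos _ (by positivity))
  have hforce (t : ℝ) : deriv (deriv (q (n - 1))) t =
      (-(m t * r t * S t) * cos (φ t), -(m t * r t * S t) * sin (φ t)) := by
    have hsin := sum_comp_cos_mul_sin_eq_zero n (by omega) fun c => f (2 * r t ^ 2 * (1 - c))
    have hx := congrArg (fun z => z * (m t * r t * sin (φ t))) hsin
    have hy := congrArg (fun z => z * (m t * r t * cos (φ t))) hsin
    simp only [zero_mul, Finset.sum_mul] at hx hy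
    rw [hmotion]
    refine Prod.ext ?_ ?_
    · rw [Prod.fst_sum, ← add_zero (Finset.sum _ _), ← hx, ← Finset.sum_add_distrib, hS]
      simp only [Finset.mul_sum, Finset.sum_mul, ← Finset.sum_neg_distrib]
      refine Finset.sum_congr rfl fun j _ => ?_
      simp only [Prod.smul_fst, Prod.fst_sub, smul_eq_mul, cos_add]
      ring
    · rw [Prod.snd_sum, ← sub_zero (Finset.sum _ _), ← hy, ← Finset.sum_sub_distrib, hS]
      simp only [Finset.mul_sum, Finset.sum_mul, ← Finset.sum_neg_distrib]
      refine Finset.sum_congr rfl fun j _ => ?_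
      simp only [Prod.smul_snd, Prod.snd_sub, smul_eq_mul, sin_add]
      ring
  have hpolar (t : ℝ) := (hforce t).symm.trans (hq_last ▸ deriv_deriv_polar hr hφ t)
  have hradial (t : ℝ) : deriv (deriv r) t - r t * deriv φ t ^ 2 = -(m t * r t * S t) := by
    obtain ⟨hx, hy⟩ := Prod.mk.inj (hpolar t)
    linear_combination -cos (φ t) * hx - sin (φ t) * hy -
      (deriv (deriv r) t - r t * deriv φ t ^ 2 + m t * r t * S t) * sin_sq_add_cos_sq (φ t)
  have htransverse (t : ℝ) : 2 * deriv r t * deriv φ t + r t * deriv (deriv φ) t = 0 := by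
    obtain ⟨hx, hy⟩ := Prod.mk.inj (hpolar t)
    linear_combination sin (φ t) * hx - cos (φ t) * hy -
      (2 * deriv r t * deriv φ t + r t * deriv (deriv φ) t) * sin_sq_add_cos_sq (φ t)
  have hmomentum (t : ℝ) : HasDerivAt (fun s => r s ^ 2 * deriv φ s) 0 t := by
    have hr1 := (hr.differentiable two_ne_zero t).hasDerivAt
    have hφ2 := (hφ.differentiable_deriv_two t).hasDerivAt
    refine ((hr1.pow 2).mul hφ2).congr_deriv ?_
    simp only [Pi.pow_apply]
    push_cast
    linear_combination r t * htransverse t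
  have hconst (t : ℝ) : r t ^ 2 * deriv φ t = r 0 ^ 2 * deriv φ 0 :=
    is_const_of_deriv_eq_zero (fun s => (hmomentum s).differentiableAt)
      (fun s => (hmomentum s).deriv) t 0
  refine ⟨r 0 ^ 2 * deriv φ 0, fun t => ?_⟩
  have hrt := (hr_pos t).ne'
  rw [← hconst t]
  refine ⟨by field_simp, ?_⟩
  rw [eq_div_iff (mul_pos (pow_pos (hr_pos t) 4) (hS_pos t)).ne']
  linear_combination r t ^ 3 * hradial t
end

section
/- Assume in addition that f is continuously differentiable on (0,∞). Then for each order of the masses there is at most one polygonal homographic orbit: if q_1,…,q_n with data (r, φ, α_1,…,α_n) and q̃_1,…,q̃_n with data (r, φ, β_1,…,β_n) are two polygonal homographic orbit solutions of the planar n-body system with the same radius function r, the same rotation function φ, the same mass functions m_1,…,m_n (in the same order), and α_1 = β_1, then α_i = β_i for all i ∈ {1,…,n}. -/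
open Real

/-- The tangential force `x ↦ sin x · f (r² (2 - 2 cos x))` between two bodies on a circle of
radius `r`, as a function of the angle between them, is strictly decreasing on `(0, 2π)`. -/
theorem strictAntiOn_tangential_force {f : ℝ → ℝ} (hf_pos : ∀ x > 0, 0 < f x)
    (hf_dec : AntitoneOn (fun x => Real.sqrt x * f x) (Set.Ioi 0)) {r : ℝ} (hr : 0 < r) :
    StrictAntiOn (fun x => Real.sin x * f (r ^ 2 * (2 - 2 * Real.cos x)))
      (Set.Ioo 0 (2 * π)) := by
  intro x hx y hy hxy
  obtain ⟨hx0, hx1⟩ := hx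
  obtain ⟨hy0, hy1⟩ := hy
  have hs : ∀ z, 0 < z → z < 2 * π → 0 < Real.sin (z / 2) := fun z h0 h1 =>
    Real.sin_pos_of_pos_of_lt_pi (by linarith) (by linarith)
  have harg : ∀ z, r ^ 2 * (2 - 2 * Real.cos z) = (2 * r * Real.sin (z / 2)) ^ 2 := fun z => by
    have h := Real.cos_sq' (z / 2)
    have h2 := Real.cos_two_mul (z / 2)
    rw [mul_div_cancel₀ z two_ne_zero] at h2
    rw [h2, h]; ring
  have hsin : ∀ z, Real.sin z = 2 * Real.sin (z / 2) * Real.cos (z / 2) := fun z => by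
    rw [← Real.sin_two_mul, mul_div_cancel₀ z two_ne_zero]
  have hG : ∀ u v, 0 < u → u ≤ v →
      v * f ((2 * r * v) ^ 2) ≤ u * f ((2 * r * u) ^ 2) := fun u v hu huv => by
    have hv : 0 < v := hu.trans_le huv
    have h := hf_dec (a := (2 * r * u) ^ 2) (b := (2 * r * v) ^ 2)
      (Set.mem_Ioi.2 (by positivity)) (Set.mem_Ioi.2 (by positivity)) (by gcongr)
    simp only at h
    rw [Real.sqrt_sq (by positivity), Real.sqrt_sq (by positivity)] at h
    have h2r : 0 < 2 * r := by positivity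
    refine le_of_mul_le_mul_left ?_ h2r
    linarith
  have hpos : ∀ u, 0 < u → 0 < u * f ((2 * r * u) ^ 2) := fun u hu =>
    mul_pos hu (hf_pos _ (by positivity))
  have hcos : Real.cos (y / 2) < Real.cos (x / 2) :=
    Real.cos_lt_cos_of_nonneg_of_le_pi (by linarith) (by linarith) (by linarith)
  have hsx := hs x hx0 hx1
  have hsy := hs y hy0 hy1
  have hPx := hpos _ hsx
  have hPy := hpos _ hsy
  have hsqx := Real.sin_sq_add_cos_sq (x / 2)
  have hsqy := Real.sin_sq_add_cos_sq (y / 2)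
  simp only [harg]
  rw [hsin x, hsin y]
  suffices h : Real.cos (y / 2) * (Real.sin (y / 2) * f ((2 * r * Real.sin (y / 2)) ^ 2)) <
      Real.cos (x / 2) * (Real.sin (x / 2) * f ((2 * r * Real.sin (x / 2)) ^ 2)) by linarith
  rcases le_total 0 (Real.cos (y / 2)) with hy | hy
  · have hle : Real.sin (x / 2) ≤ Real.sin (y / 2) := by
      by_contra! hlt
      nlinarith
    have h := hG _ _ hsx hle
    calc _ ≤ Real.cos (y / 2) * (Real.sin (x / 2) * f ((2 * r * Real.sin (x / 2)) ^ 2)) := by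
            gcongr
      _ < _ := by gcongr
  · rcases le_total 0 (Real.cos (x / 2)) with hx | hx
    · rcases hx.lt_or_eq with hx | hx
      · nlinarith [mul_pos hx hPx]
      · nlinarith
    · have hle : Real.sin (y / 2) ≤ Real.sin (x / 2) := by
        by_contra! hlt
        nlinarith
      have h := hG _ _ hsy hle
      calc _ < Real.cos (x / 2) * (Real.sin (y / 2) * f ((2 * r * Real.sin (y / 2)) ^ 2)) := by
              gcongr
        _ ≤ _ := mul_le_mul_of_nonpos_left h hx

/-- The second derivative of a plane curve rotated by a fixed angle `a`. -/
theorem deriv_deriv_rotate {c s : ℝ → ℝ} (hc : ContDiff ℝ 2 c) (hs : ContDiff ℝ 2 s) (a : ℝ) :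
    deriv (deriv fun t => (Real.cos a * c t - Real.sin a * s t,
      Real.sin a * c t + Real.cos a * s t)) =
    fun t => (Real.cos a * deriv (deriv c) t - Real.sin a * deriv (deriv s) t,
      Real.sin a * deriv (deriv c) t + Real.cos a * deriv (deriv s) t) := by
  have key : ∀ {c s : ℝ → ℝ}, Differentiable ℝ c → Differentiable ℝ s →
      (deriv fun t => (Real.cos a * c t - Real.sin a * s t,
        Real.sin a * c t + Real.cos a * s t)) =
      fun t => (Real.cos a * deriv c t - Real.sin a * deriv s t,
        Real.sin a * deriv c t + Real.cos a * deriv s t) := by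
    intro c s hc hs
    funext t
    have h1 := (hc t).hasDerivAt
    have h2 := (hs t).hasDerivAt
    exact (((h1.const_mul _).sub (h2.const_mul _)).prodMk
      ((h1.const_mul _).add (h2.const_mul _))).deriv
  have hd : ∀ {g : ℝ → ℝ}, ContDiff ℝ 2 g → Differentiable ℝ (deriv g) := fun hg =>
    ((contDiff_succ_iff_deriv (n := 1)).1 hg).2.2.differentiable (by norm_num)
  rw [key (hc.differentiable (by norm_num)) (hs.differentiable (by norm_num)),
    key (hd hc) (hd hs)]

/-- The tangential component of the equations of motion along a polygonal homographic orbit: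
up to the factor `r`, the tangential force on body `i` does not depend on `i` or the phases. -/
theorem tangential_force_eq {n : ℕ} {f : ℝ → ℝ} {m : ℕ → ℝ → ℝ} {r φ : ℝ → ℝ}
    (hr : ContDiff ℝ 2 r) (hφ : ContDiff ℝ 2 φ) {α : ℕ → ℝ} {q : ℕ → ℝ → ℝ × ℝ}
    (hq : ∀ i < n, ∀ t,
      q i t = (r t * Real.cos (φ t + α i), r t * Real.sin (φ t + α i)))
    (hODE : ∀ i < n, ∀ t, deriv (deriv (q i)) t =
      ∑ j ∈ (Finset.range n).erase i,
        (m j t * f (((q j t).1 - (q i t).1) ^ 2 + ((q j t).2 - (q i t).2) ^ 2)) •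
          (q j t - q i t))
    {i : ℕ} (hi : i < n) (t : ℝ) :
    r t * ∑ j ∈ (Finset.range n).erase i, m j t *
      (Real.sin (α j - α i) * f (r t ^ 2 * (2 - 2 * Real.cos (α j - α i)))) =
    Real.cos (φ t) * deriv (deriv fun u => r u * Real.sin (φ u)) t -
      Real.sin (φ t) * deriv (deriv fun u => r u * Real.cos (φ u)) t := by
  have hqi : q i = fun u =>
      (Real.cos (α i) * (r u * Real.cos (φ u)) - Real.sin (α i) * (r u * Real.sin (φ u)),
        Real.sin (α i) * (r u * Real.cos (φ u)) + Real.cos (α i) * (r u * Real.sin (φ u))) := by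
    funext u
    rw [hq i hi, Real.cos_add, Real.sin_add]
    ext <;> simp only <;> ring
  have h := hODE i hi t
  rw [hqi, deriv_deriv_rotate (hr.mul hφ.cos) (hr.mul hφ.sin), ← hqi] at h
  have h1 := congrArg Prod.fst h
  have h2 := congrArg Prod.snd h
  simp only [Prod.fst_sum, Prod.snd_sum, Prod.smul_fst, Prod.smul_snd, Prod.fst_sub,
    Prod.snd_sub, smul_eq_mul] at h1 h2
  have hproj := congrArg₂ (fun x y => Real.cos (φ t + α i) * y - Real.sin (φ t + α i) * x) h1 h2
  simp only [Finset.mul_sum, ← Finset.sum_sub_distrib] at hproj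
  have hrot : Real.sin (α i) ^ 2 + Real.cos (α i) ^ 2 = 1 := Real.sin_sq_add_cos_sq _
  rw [Finset.mul_sum]
  refine Eq.trans ?_ (hproj.symm.trans ?_)
  · refine Finset.sum_congr rfl fun j hj => ?_
    have hjn : j < n := Finset.mem_range.1 (Finset.mem_of_mem_erase hj)
    have hdiff : α j - α i = (φ t + α j) - (φ t + α i) := by ring
    have hsq : (r t * Real.cos (φ t + α j) - r t * Real.cos (φ t + α i)) ^ 2 +
        (r t * Real.sin (φ t + α j) - r t * Real.sin (φ t + α i)) ^ 2 =
        r t ^ 2 * (2 - 2 * Real.cos (α j - α i)) := by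
      rw [hdiff, Real.cos_sub]
      linear_combination r t ^ 2 * Real.sin_sq_add_cos_sq (φ t + α j) +
        r t ^ 2 * Real.sin_sq_add_cos_sq (φ t + α i)
    rw [hq j hjn, hq i hi]
    simp only [hsq]
    have hsin : Real.sin (α j - α i) = Real.sin (φ t + α j) * Real.cos (φ t + α i) -
        Real.cos (φ t + α j) * Real.sin (φ t + α i) := by rw [hdiff, Real.sin_sub]
    rw [hsin]
    ring
  · rw [Real.cos_add, Real.sin_add]
    linear_combination
      (Real.cos (φ t) * deriv (deriv fun u => r u * Real.sin (φ u)) t -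
        Real.sin (φ t) * deriv (deriv fun u => r u * Real.cos (φ u)) t) * hrot

/-- (uniqueness of polygonal homographic orbits for a given order of the
masses) If `f` is moreover continuously differentiable on `(0,∞)` and two polygonal
homographic orbit solutions of the planar `n`-body problem share the same radius
function `r`, rotation function `φ`, mass functions `m_0, …, m_{n-1}` (in the same
order) and the same first phase `α 0 = β 0`, then all their phases agree.
Bodies are indexed by `i ∈ {0, …, n-1}`. -/
theorem homographic_orbit_unique
    (n : ℕ) (hn : 2 ≤ n)
    -- the kernel `f`: positive on `(0,∞)`, `x ↦ √x · f x` decreasing on `(0,∞)`,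
    -- and continuously differentiable on `(0,∞)`
    (f : ℝ → ℝ) (hf_pos : ∀ x > 0, 0 < f x)
    (hf_dec : AntitoneOn (fun x => Real.sqrt x * f x) (Set.Ioi 0))
    (hf_C1 : ContDiffOn ℝ 1 f (Set.Ioi 0))
    -- the mass functions, everywhere positive
    (m : ℕ → ℝ → ℝ) (hm : ∀ i < n, ∀ t, 0 < m i t)
    -- the common radius, twice continuously differentiable and positive
    (r : ℝ → ℝ) (hr : ContDiff ℝ 2 r) (hr_pos : ∀ t, 0 < r t)
    -- the common rotation angle, twice continuously differentiable
    (φ : ℝ → ℝ) (hφ : ContDiff ℝ 2 φ)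
    -- two families of constant phases, each with `0 ≤ ·₀ < ·₁ < … < ·_{n-1} < 2π`
    (α β : ℕ → ℝ)
    (hα0 : 0 ≤ α 0) (hαord : ∀ i j, i < j → j < n → α i < α j)
    (hα2π : ∀ i < n, α i < 2 * π)
    (hβ0 : 0 ≤ β 0) (hβord : ∀ i j, i < j → j < n → β i < β j)
    (hβ2π : ∀ i < n, β i < 2 * π)
    -- the two solutions
    (q qt : ℕ → ℝ → ℝ × ℝ)
    (hq : ∀ i < n, ∀ t,
      q i t = (r t * Real.cos (φ t + α i), r t * Real.sin (φ t + α i)))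
    (hqt : ∀ i < n, ∀ t,
      qt i t = (r t * Real.cos (φ t + β i), r t * Real.sin (φ t + β i)))
    -- both satisfy the equations of motion with the same masses
    (hODE : ∀ i < n, ∀ t, deriv (deriv (q i)) t =
      ∑ j ∈ (Finset.range n).erase i,
        (m j t * f (((q j t).1 - (q i t).1) ^ 2 + ((q j t).2 - (q i t).2) ^ 2)) •
          (q j t - q i t))
    (hODEt : ∀ i < n, ∀ t, deriv (deriv (qt i)) t =
      ∑ j ∈ (Finset.range n).erase i,
        (m j t * f (((qt j t).1 - (qt i t).1) ^ 2 + ((qt j t).2 - (qt i t).2) ^ 2)) •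
          (qt j t - qt i t))
    -- the first phases agree
    (h0 : α 0 = β 0) :
    -- conclusion: all phases agree
    ∀ i < n, α i = β i := by
  have hanti := strictAntiOn_tangential_force hf_pos hf_dec (hr_pos 0)
  set h : ℝ → ℝ := fun x => Real.sin x * f (r 0 ^ 2 * (2 - 2 * Real.cos x)) with hh
  have hper : ∀ x, h (x + 2 * π) = h x := fun x => by
    simp only [hh, Real.sin_add_two_pi, Real.cos_add_two_pi]
  obtain ⟨k, hk, hkmax⟩ := Finset.exists_max_image (Finset.range n) (fun i => α i - β i)
    ⟨0, Finset.mem_range.2 (by omega)⟩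
  have hkn := Finset.mem_range.1 hk
  have hα_nonneg : ∀ i < n, 0 ≤ α i := fun i hi => by
    rcases Nat.eq_zero_or_pos i with rfl | hi0
    · exact hα0
    · exact hα0.trans (hαord 0 i hi0 hi).le
  have hβ_nonneg : ∀ i < n, 0 ≤ β i := fun i hi => by
    rcases Nat.eq_zero_or_pos i with rfl | hi0
    · exact hβ0
    · exact hβ0.trans (hβord 0 i hi0 hi).le
  have hlt : ∀ j < n, j ≠ k → α j - β j < α k - β k → h (β j - β k) < h (α j - α k) := by
    intro j hj hjk hw
    have := hα_nonneg j hj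
    have := hβ_nonneg j hj
    have := hα_nonneg k hkn
    have := hβ_nonneg k hkn
    have := hα2π j hj
    have := hβ2π j hj
    have := hα2π k hkn
    have := hβ2π k hkn
    rcases lt_or_gt_of_ne hjk with hlt | hgt
    · have := hαord j k hlt hkn
      have := hβord j k hlt hkn
      rw [← hper (β j - β k), ← hper (α j - α k)]
      exact hanti ⟨by linarith, by linarith⟩ ⟨by linarith, by linarith⟩ (by linarith)
    · have := hαord k j hgt hj
      have := hβord k j hgt hj
      exact hanti ⟨by linarith, by linarith⟩ ⟨by linarith, by linarith⟩ (by linarith)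
  have hle : ∀ j ∈ (Finset.range n).erase k,
      m j 0 * h (β j - β k) ≤ m j 0 * h (α j - α k) := fun j hj => by
    have hjn := Finset.mem_range.1 (Finset.mem_of_mem_erase hj)
    refine mul_le_mul_of_nonneg_left ?_ (hm j hjn 0).le
    rcases (hkmax j (Finset.mem_of_mem_erase hj)).lt_or_eq with hw | hw
    · exact (hlt j hjn (Finset.ne_of_mem_erase hj) hw).le
    · rw [show β j - β k = α j - α k by linarith]
  have hsum : ∑ j ∈ (Finset.range n).erase k, m j 0 * h (β j - β k) =
      ∑ j ∈ (Finset.range n).erase k, m j 0 * h (α j - α k) :=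
    mul_left_cancel₀ (hr_pos 0).ne' ((tangential_force_eq hr hφ hqt hODEt hkn 0).trans
      (tangential_force_eq hr hφ hq hODE hkn 0).symm)
  have heq := (Finset.sum_eq_sum_iff_of_le hle).1 hsum
  have hconst : ∀ j < n, α j - β j = α k - β k := fun j hj => by
    rcases eq_or_ne j k with rfl | hjk
    · rfl
    · refine (hkmax j (Finset.mem_range.2 hj)).eq_of_not_lt fun hw => ?_
      have h1 := heq j (Finset.mem_erase.2 ⟨hjk, Finset.mem_range.2 hj⟩)
      exact (mul_lt_mul_of_pos_left (hlt j hj hjk hw) (hm j hj 0)).ne h1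
  intro i hi
  linarith [hconst i hi, hconst 0 (by omega)]
end
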